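/- arXiv:1710.05192 — 3 statements merged into one kernel-verified Lean document; each statement's English description precedes it below -/
import Mathlib

section
/- Let (Ω,F,Q) be a probability space and (X,Y) : Ω → ℝ × ℝⁿ a random vector whose joint law is multivariate Gaussian with mean vector (m₀, m) ∈ ℝ × ℝⁿ and covariance matrix in block form [[k, bᵀ],[b, A]], with A ∈ ℝ^{n×n} symmetric positive definite. For any ŷ ∈ ℝⁿ and ε > 0, let B := {v ∈ ℝⁿ : ‖v − ŷ‖₂ ≤ ε} be the closed Euclidean ball. Then Q(Y ∈ B) > 0, and the conditional mean of X given the event {Y ∈ B} satisfies (1/Q(Y∈B)) ∫_{{Y∈B}} X dQ = m₀ + bᵀA⁻¹(η − m), where η := (1/Q(Y∈B)) ∫_{{Y∈B}} Y dQ ∈ ℝⁿ is the conditional mean of Y given {Y ∈ B}. -/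
open MeasureTheory ProbabilityTheory Matrix

/-- The standard Gaussian measure on Euclidean space charges every nonempty open set. -/
lemma isOpenPosMeasure_stdGaussian {ι : Type*} [Fintype ι] :
    (stdGaussian (EuclideanSpace ℝ ι)).IsOpenPosMeasure := by
  have : (gaussianReal 0 1).IsOpenPosMeasure :=
    (gaussianReal_absolutelyContinuous' 0 one_ne_zero).isOpenPosMeasure
  rw [← map_pi_eq_stdGaussian]
  exact (PiLp.continuous_toLp 2 _).isOpenPosMeasure_map (WithLp.toLp_surjective 2)

open scoped MatrixOrder in
/-- A multivariate Gaussian measure with positive definite covariance matrix charges every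
nonempty open set. -/
lemma Matrix.PosDef.isOpenPosMeasure_multivariateGaussian {ι : Type*} [Fintype ι] [DecidableEq ι]
    (μ : EuclideanSpace ℝ ι) {A : Matrix ι ι ℝ} (hA : A.PosDef) :
    (multivariateGaussian μ A).IsOpenPosMeasure := by
  have := isOpenPosMeasure_stdGaussian (ι := ι)
  refine Continuous.isOpenPosMeasure_map (by fun_prop) fun y ↦ ?_
  have h : toEuclideanCLM (𝕜 := ℝ) (CFC.sqrt A) * toEuclideanCLM (𝕜 := ℝ) (CFC.sqrt A) *
      toEuclideanCLM (𝕜 := ℝ) A⁻¹ = 1 := by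
    rw [← map_mul, ← map_mul, CFC.sqrt_mul_sqrt_self A hA.posSemidef.nonneg,
      mul_nonsing_inv A hA.det_pos.ne'.isUnit, map_one]
  refine ⟨toEuclideanCLM (𝕜 := ℝ) (CFC.sqrt A) (toEuclideanCLM (𝕜 := ℝ) A⁻¹ (y - μ)), ?_⟩
  have h' := congrArg (fun f ↦ f (y - μ)) h
  simp only [mul_apply_eq_comp, one_apply_eq_self] at h'
  simp only [h', add_sub_cancel]

/-- A random vector whose linear functionals have the Gaussian laws prescribed by `m` and `A`
has law `multivariateGaussian m A`. -/
lemma map_toLp_eq_multivariateGaussian {Ω ι : Type*} [MeasurableSpace Ω] [Fintype ι]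
    [DecidableEq ι] {Q : Measure Ω} [IsProbabilityMeasure Q] {Y : Ω → ι → ℝ} (hY : Measurable Y)
    {m : ι → ℝ} {A : Matrix ι ι ℝ} (hA : A.PosSemidef)
    (hlaw : ∀ t : ι → ℝ, Q.map (fun ω ↦ t ⬝ᵥ Y ω) =
      gaussianReal (t ⬝ᵥ m) (Real.toNNReal (t ⬝ᵥ A *ᵥ t))) :
    Q.map (fun ω ↦ WithLp.toLp 2 (Y ω)) = multivariateGaussian (WithLp.toLp 2 m) A := by
  have hmeas : Measurable fun ω ↦ WithLp.toLp 2 (Y ω) := by fun_prop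
  have := Measure.isProbabilityMeasure_map (μ := Q) hmeas.aemeasurable
  apply Measure.ext_of_charFun
  ext t
  have hnonneg : 0 ≤ t.ofLp ⬝ᵥ A *ᵥ t.ofLp := by simpa using hA.dotProduct_mulVec_nonneg t.ofLp
  have h : charFun (Q.map fun ω ↦ WithLp.toLp 2 (Y ω)) t =
      charFun (Q.map fun ω ↦ t.ofLp ⬝ᵥ Y ω) 1 := by
    rw [charFun_apply, charFun_apply_real, integral_map hmeas.aemeasurable (by fun_prop),
      integral_map (by unfold dotProduct; fun_prop) (by fun_prop)]
    simp [EuclideanSpace.inner_eq_star_dotProduct]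
  rw [h, hlaw, charFun_gaussianReal, charFun_multivariateGaussian hA]
  simp [EuclideanSpace.inner_eq_star_dotProduct, hnonneg, dotProduct_comm]

/-- The expectation of `W` over an event determined by `Y`, when `W` is independent of `Y`. -/
lemma ProbabilityTheory.IndepFun.setIntegral_preimage {Ω E : Type*} [MeasurableSpace Ω]
    [MeasurableSpace E] {Q : Measure Ω} {W : Ω → ℝ} {Y : Ω → E} (hW : Measurable W)
    (hY : Measurable Y) (h : IndepFun W Y Q) {B : Set E} (hB : MeasurableSet B) :
    ∫ ω in Y ⁻¹' B, W ω ∂Q = (∫ ω, W ω ∂Q) * Q.real (Y ⁻¹' B) := by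
  have hB' : Measurable (B.indicator (1 : E → ℝ)) := measurable_one.indicator hB
  have h1 := (h.comp measurable_id hB').integral_fun_mul_eq_mul_integral
    (by fun_prop) (hB'.comp hY).aestronglyMeasurable
  simp only [Function.comp_apply, id_eq] at h1
  have h2 : (fun ω ↦ B.indicator (1 : E → ℝ) (Y ω)) = (Y ⁻¹' B).indicator 1 := by
    rfl
  rw [h2, integral_indicator_one (hY hB)] at h1
  rw [← h1, ← integral_indicator (hY hB)]
  congr 1
  ext ω
  by_cases hω : Y ω ∈ B <;> simp [hω]

/-- Every continuous linear functional on `ι → ℝ` is a dot product. -/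
lemma exists_dotProduct_eq_strongDual {ι : Type*} [Fintype ι] (L : (ι → ℝ) →L[ℝ] ℝ) :
    ∃ t : ι → ℝ, ∀ y, L y = t ⬝ᵥ y := by
  classical
  refine ⟨fun i ↦ L (Pi.single i 1), fun y ↦ ?_⟩
  conv_lhs => rw [pi_eq_sum_univ' y]
  simp [dotProduct, mul_comm]

/-- A covariance vanishes as soon as adding and subtracting give the same variance. -/
lemma covariance_eq_zero_of_variance_add_eq_variance_sub {Ω : Type*} [MeasurableSpace Ω]
    {Q : Measure Ω} [IsProbabilityMeasure Q] {U V : Ω → ℝ} (hU : MemLp U 2 Q) (hV : MemLp V 2 Q)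
    (h : Var[U + V; Q] = Var[U - V; Q]) : cov[U, V; Q] = 0 := by
  rw [variance_add hU hV, variance_sub hU hV] at h
  linarith

/-- If `(X, Y)` is jointly Gaussian and `A u = b`, the linear functionals of the residual `X - uᵀY`
and `Y` are Gaussian, with no cross term in the variance. -/
lemma map_residual_add_dotProduct {Ω : Type*} [MeasurableSpace Ω] {Q : Measure Ω}
    {n : ℕ} {X : Ω → ℝ} {Y : Ω → Fin n → ℝ} {m₀ : ℝ} {m : Fin n → ℝ} {k : ℝ} {b u : Fin n → ℝ}
    {A : Matrix (Fin n) (Fin n) ℝ} (hA : A.IsSymm) (hu : A *ᵥ u = b)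
    (hGauss : ∀ (t₀ : ℝ) (t : Fin n → ℝ),
      Q.map (fun ω => t₀ * X ω + t ⬝ᵥ Y ω) =
        gaussianReal (t₀ * m₀ + t ⬝ᵥ m)
          (Real.toNNReal (t₀ ^ 2 * k + 2 * t₀ * (t ⬝ᵥ b) + t ⬝ᵥ A.mulVec t)))
    (s : ℝ) (t : Fin n → ℝ) :
    Q.map (fun ω ↦ s * (X ω - u ⬝ᵥ Y ω) + t ⬝ᵥ Y ω) =
      gaussianReal (s * (m₀ - u ⬝ᵥ m) + t ⬝ᵥ m)
        (Real.toNNReal (s ^ 2 * (k - u ⬝ᵥ b) + t ⬝ᵥ A *ᵥ t)) := by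
  have hut : u ⬝ᵥ A *ᵥ t = t ⬝ᵥ b := by
    rw [dotProduct_mulVec, ← mulVec_transpose, hA.eq, hu, dotProduct_comm]
  convert hGauss s (t - s • u) using 2
  · ext ω
    simp only [sub_dotProduct, smul_dotProduct, smul_eq_mul]
    ring
  · simp only [sub_dotProduct, smul_dotProduct, smul_eq_mul]
    ring
  · congr 1
    simp only [sub_dotProduct, smul_dotProduct, smul_eq_mul, mulVec_sub, mulVec_smul,
      dotProduct_sub, dotProduct_smul, hu, hut]
    ring

/-- A pair `(W, Y)` whose linear functionals have Gaussian laws without cross terms in the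
variance is independent. -/
lemma indepFun_of_map_eq_gaussianReal {Ω : Type*} [MeasurableSpace Ω] {Q : Measure Ω}
    [IsProbabilityMeasure Q] {ι : Type*} [Fintype ι] {W : Ω → ℝ} {Y : Ω → ι → ℝ}
    (hW : Measurable W) (hY : Measurable Y) {μ₀ c : ℝ} {m : ι → ℝ} {A : Matrix ι ι ℝ}
    (hlaw : ∀ (s : ℝ) (t : ι → ℝ), Q.map (fun ω ↦ s * W ω + t ⬝ᵥ Y ω) =
      gaussianReal (s * μ₀ + t ⬝ᵥ m) (Real.toNNReal (s ^ 2 * c + t ⬝ᵥ A *ᵥ t))) :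
    IndepFun W Y Q := by
  have hvar (s : ℝ) (t : ι → ℝ) : Var[fun ω ↦ s * W ω + t ⬝ᵥ Y ω; Q] =
      Real.toNNReal (s ^ 2 * c + t ⬝ᵥ A *ᵥ t) := by
    rw [← variance_id_gaussianReal (μ := s * μ₀ + t ⬝ᵥ m), ← hlaw, variance_map aemeasurable_id
      (by unfold dotProduct; fun_prop)]
    rfl
  have hdual (L : (ℝ × (ι → ℝ)) →L[ℝ] ℝ) :
      ∃ (s : ℝ) (t : ι → ℝ), ∀ w y, L (w, y) = s * w + t ⬝ᵥ y := by
    obtain ⟨t, ht⟩ := exists_dotProduct_eq_strongDual (L ∘L .inr ℝ ℝ (ι → ℝ))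
    refine ⟨L (1, 0), t, fun w y ↦ ?_⟩
    rw [← ht y]
    calc L (w, y) = L (w • (1, 0) + (0, y)) := by simp
      _ = _ := by rw [map_add, map_smul, smul_eq_mul, mul_comm]; rfl
  have hWY : HasGaussianLaw (fun ω ↦ (W ω, Y ω)) Q := by
    refine ⟨isGaussian_of_map_eq_gaussianReal fun L ↦ ?_⟩
    obtain ⟨s, t, hL⟩ := hdual L
    refine ⟨s * μ₀ + t ⬝ᵥ m, Real.toNNReal (s ^ 2 * c + t ⬝ᵥ A *ᵥ t), ?_⟩
    rw [Measure.map_map (by fun_prop) (by fun_prop), ← hlaw s t]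
    congr 1
    ext ω
    exact hL _ _
  refine hWY.indepFun_of_covariance_strongDual fun L₁ L₂ ↦ ?_
  obtain ⟨t, ht⟩ := exists_dotProduct_eq_strongDual L₂
  have hL₁ (w : ℝ) : L₁ w = L₁ 1 * w := by
    rw [← mul_one w, ← smul_eq_mul w 1, map_smul]; simp [mul_comm]
  refine covariance_eq_zero_of_variance_add_eq_variance_sub
    ((hWY.fst.map L₁).memLp_two) ((hWY.snd.map L₂).memLp_two) ?_
  have h₁ : L₁ ∘ W + L₂ ∘ Y = fun ω ↦ L₁ 1 * W ω + t ⬝ᵥ Y ω := by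
    ext ω; simp [ht, hL₁ (W ω)]
  have h₂ : L₁ ∘ W - L₂ ∘ Y = fun ω ↦ L₁ 1 * W ω + (-t) ⬝ᵥ Y ω := by
    ext ω; simp [ht, hL₁ (W ω), sub_eq_add_neg]
  rw [h₁, h₂, hvar, hvar]
  simp [mulVec_neg]

/-- If `(X,Y)` is jointly Gaussian with mean `(m₀, m)` and block
covariance `[[k, bᵀ],[b, A]]`, `A` symmetric positive definite, then for any closed
Euclidean ball `B = {v : ‖v − ŷ‖₂ ≤ ε}` (`ε > 0`) the event `{Y ∈ B}` has positive
probability and the conditional mean of `X` given `{Y ∈ B}` equals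
`m₀ + bᵀA⁻¹(η − m)`, where `η` is the conditional mean of `Y` given `{Y ∈ B}`. -/
theorem condMean_given_ball_event
    {Ω : Type*} [MeasurableSpace Ω] (Q : Measure Ω) [IsProbabilityMeasure Q]
    {n : ℕ} (X : Ω → ℝ) (Y : Ω → Fin n → ℝ) (hX : Measurable X) (hY : Measurable Y)
    (m₀ : ℝ) (m : Fin n → ℝ) (k : ℝ) (b : Fin n → ℝ)
    (A : Matrix (Fin n) (Fin n) ℝ) (hA : A.PosDef)
    (hGauss : ∀ (t₀ : ℝ) (t : Fin n → ℝ),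
      Q.map (fun ω => t₀ * X ω + t ⬝ᵥ Y ω) =
        gaussianReal (t₀ * m₀ + t ⬝ᵥ m)
          (Real.toNNReal (t₀ ^ 2 * k + 2 * t₀ * (t ⬝ᵥ b) + t ⬝ᵥ A.mulVec t)))
    (yhat : Fin n → ℝ) (ε : ℝ) (hε : 0 < ε)
    (S : Set Ω) (hS : S = {ω | ∑ i, (Y ω i - yhat i) ^ 2 ≤ ε ^ 2})
    (η : Fin n → ℝ) (hη : ∀ i, η i = (∫ ω in S, Y ω i ∂Q) / (Q S).toReal) :
    0 < Q S ∧
      (∫ ω in S, X ω ∂Q) / (Q S).toReal =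
        m₀ + b ⬝ᵥ A⁻¹.mulVec (fun i => η i - m i) := by
  set u := A⁻¹ *ᵥ b with hu_def
  have hsymm : A.IsSymm := by
    simpa [IsHermitian, IsSymm, conjTranspose_eq_transpose_of_trivial] using hA.1
  have hu : A *ᵥ u = b := by
    rw [hu_def, mulVec_mulVec, mul_nonsing_inv A hA.det_pos.ne'.isUnit, one_mulVec]
  have hlaw := map_residual_add_dotProduct hsymm hu hGauss
  have hYlaw := map_toLp_eq_multivariateGaussian (Q := Q) hY (m := m) hA.posSemidef
    fun t ↦ by simpa using hGauss 0 t
  set W : Ω → ℝ := fun ω ↦ X ω - u ⬝ᵥ Y ω with hW_def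
  have hW : Measurable W := by unfold W dotProduct; fun_prop
  have hindep : IndepFun W Y Q := indepFun_of_map_eq_gaussianReal hW hY hlaw
  have hWlaw : Q.map W = gaussianReal (m₀ - u ⬝ᵥ m) (Real.toNNReal (k - u ⬝ᵥ b)) := by
    simpa using hlaw 1 0
  have hWint : Integrable W Q :=
    (HasGaussianLaw.mk (hWlaw ▸ isGaussian_gaussianReal _ _)).integrable
  have hWmean : ∫ ω, W ω ∂Q = m₀ - u ⬝ᵥ m := by
    rw [← integral_id_gaussianReal (μ := m₀ - u ⬝ᵥ m), ← hWlaw, integral_map (by fun_prop)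
      (by fun_prop)]
  have hYint (i : Fin n) : Integrable (fun ω ↦ Y ω i) Q := by
    have h := hGauss 0 (Pi.single i 1)
    simp only [zero_mul, zero_add, single_one_dotProduct] at h
    exact (HasGaussianLaw.mk (h ▸ isGaussian_gaussianReal _ _)).integrable
  have hB : MeasurableSet {y : Fin n → ℝ | ∑ i, (y i - yhat i) ^ 2 ≤ ε ^ 2} :=
    measurableSet_le (by fun_prop) (by fun_prop)
  have hpos : 0 < Q S := by
    have := hA.isOpenPosMeasure_multivariateGaussian (WithLp.toLp 2 m)
    have h := Metric.measure_ball_pos (multivariateGaussian (WithLp.toLp 2 m) A)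
      (WithLp.toLp 2 yhat) hε
    rw [← hYlaw, Measure.map_apply (by fun_prop) measurableSet_ball] at h
    refine h.trans_le (measure_mono fun ω hω ↦ ?_)
    rw [Set.mem_preimage, Metric.mem_ball, EuclideanSpace.dist_eq] at hω
    simpa [hS, Real.dist_eq] using ((Real.sqrt_lt' hε).1 hω).le
  refine ⟨hpos, ?_⟩
  have hQS : (Q S).toReal ≠ 0 := (ENNReal.toReal_pos hpos.ne' (measure_ne_top Q S)).ne'
  have hWS : ∫ ω in S, W ω ∂Q = (m₀ - u ⬝ᵥ m) * (Q S).toReal := by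
    rw [← hWmean, hS]
    exact hindep.setIntegral_preimage hW hY hB
  have hYS : ∫ ω in S, u ⬝ᵥ Y ω ∂Q = (u ⬝ᵥ η) * (Q S).toReal := by
    simp only [dotProduct]
    rw [integral_finsetSum _ fun i _ ↦ ((hYint i).const_mul (u i)).integrableOn, Finset.sum_mul]
    refine Finset.sum_congr rfl fun i _ ↦ ?_
    rw [integral_const_mul, hη, mul_assoc, div_mul_cancel₀ _ hQS]
  have huYint : Integrable (fun ω ↦ u ⬝ᵥ Y ω) Q :=
    integrable_finsetSum _ fun i _ ↦ (hYint i).const_mul (u i)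
  have hX_eq : ∫ ω in S, X ω ∂Q = ∫ ω in S, W ω ∂Q + ∫ ω in S, u ⬝ᵥ Y ω ∂Q := by
    rw [← integral_add hWint.integrableOn huYint.integrableOn]
    simp [hW_def]
  have hbu : b ⬝ᵥ A⁻¹ *ᵥ (fun i ↦ η i - m i) = u ⬝ᵥ (η - m) := by
    rw [dotProduct_mulVec, ← mulVec_transpose, transpose_nonsing_inv, hsymm.eq]
    rfl
  rw [hbu, hX_eq, hWS, hYS, ← add_mul, mul_div_cancel_right₀ _ hQS, dotProduct_sub]
  ring
end

section
/- Let E be a real separable Banach space and P a Gaussian Borel probability measure on E with mean μ := ∫_E ω dP(ω) and covariance kernel K(L₁,L₂) := ∫_E (L₁ω − L₁μ)(L₂ω − L₂μ) dP(ω). Let u ∈ E and (L_i)_{i∈ℕ} ⊆ E* be such that ⋂_{i∈ℕ} {ω ∈ E : L_iω = L_iu} = {u}, and assume that for every n the matrix A_n := (K(L_j,L_k))_{j,k=1}^n is positive definite. Then for every L ∈ E*, the conditional standard deviations converge to zero: K(L,L) − b_n(L)ᵀ A_n⁻¹ b_n(L) → 0 as n → ∞, where b_n(L) := (K(L,L₁),…,K(L,Lₙ))ᵀ.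 -/
open MeasureTheory ProbabilityTheory Matrix Filter

/-- If the Gram matrix `A` of finitely many vectors is invertible, then `⟪x, x⟫ - bᵀ A⁻¹ b`,
where `b i = ⟪x, v i⟫`, is the squared distance from `x` to some point `p` of their span,
and `p` is closest to `x` in the span. -/
theorem exists_norm_sq_eq_and_le_of_gram {H ι : Type*} [NormedAddCommGroup H]
    [InnerProductSpace ℝ H] [Fintype ι] [DecidableEq ι] (v : ι → H) (A : Matrix ι ι ℝ)
    (hA : ∀ j k, A j k = inner ℝ (v j) (v k)) (hdet : IsUnit A.det) (x : H) :
    ∃ p : H, inner ℝ x x - (fun i => inner ℝ x (v i)) ⬝ᵥ A⁻¹ *ᵥ (fun i => inner ℝ x (v i)) =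
        ‖x - p‖ ^ 2 ∧
      ∀ y ∈ Submodule.span ℝ (Set.range v), ‖x - p‖ ^ 2 ≤ ‖x - y‖ ^ 2 := by
  set b : ι → ℝ := fun i => inner ℝ x (v i) with hb
  set c : ι → ℝ := A⁻¹ *ᵥ b with hc
  have hAc : A *ᵥ c = b := by
    rw [hc, mulVec_mulVec, mul_nonsing_inv A hdet, one_mulVec]
  set p : H := ∑ i, c i • v i with hp
  have hpS : p ∈ Submodule.span ℝ (Set.range v) :=
    Submodule.sum_mem _ fun i _ =>
      Submodule.smul_mem _ _ (Submodule.subset_span (Set.mem_range_self i))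
  have horth_v : ∀ j, inner ℝ (v j) (x - p) = 0 := fun j => by
    have h := congrFun hAc j
    simp only [mulVec, dotProduct, hA, hb] at h
    rw [inner_sub_right, hp, inner_sum, real_inner_comm, ← h, sub_eq_zero]
    exact Finset.sum_congr rfl fun i _ => by rw [inner_smul_right, mul_comm]
  have horth : ∀ y ∈ Submodule.span ℝ (Set.range v), inner ℝ (x - p) y = 0 := by
    have hmem : x - p ∈ (Submodule.span ℝ (Set.range v))ᗮ := by
      rw [Submodule.mem_orthogonal]
      intro w hw
      induction hw using Submodule.span_induction with
      | mem w hw => obtain ⟨j, rfl⟩ := hw; exact horth_v j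
      | zero => exact inner_zero_left _
      | add w z _ _ hw hz => rw [inner_add_left, hw, hz, add_zero]
      | smul a w _ hw => rw [real_inner_smul_left, hw, mul_zero]
    exact fun y hy => Submodule.inner_left_of_mem_orthogonal hy hmem
  refine ⟨p, ?_, fun y hy => ?_⟩
  · have hxp : inner ℝ x p = b ⬝ᵥ c := by
      simp only [hp, inner_sum, inner_smul_right, dotProduct, hb]
      exact Finset.sum_congr rfl fun i _ => mul_comm _ _
    have h := horth p hpS
    rw [← hxp, ← inner_sub_right, ← real_inner_self_eq_norm_sq, inner_sub_left x p (x - p),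
      real_inner_comm, real_inner_comm (x - p) p, h, sub_zero]
  · have h := horth (p - y) (Submodule.sub_mem _ hpS hy)
    have hxy : x - y = (x - p) + (p - y) := by abel
    rw [hxy, norm_add_sq_real, h]
    nlinarith [sq_nonneg ‖p - y‖]

/-- If `x` lies in the closed span of a sequence with invertible Gram matrices `A n`, then the
Schur complements `⟪x, x⟫ - bₙᵀ (A n)⁻¹ bₙ` tend to zero. -/
theorem tendsto_gram_schur_complement_zero {H : Type*} [NormedAddCommGroup H]
    [InnerProductSpace ℝ H] (v : ℕ → H) (A : (n : ℕ) → Matrix (Fin n) (Fin n) ℝ)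
    (hA : ∀ n (j k : Fin n), A n j k = inner ℝ (v j) (v k)) (hdet : ∀ n, IsUnit (A n).det)
    {x : H} (hx : x ∈ (Submodule.span ℝ (Set.range v)).topologicalClosure) :
    Tendsto (fun n : ℕ => inner ℝ x x - (fun i : Fin n => inner ℝ x (v i)) ⬝ᵥ
      (A n)⁻¹ *ᵥ (fun i : Fin n => inner ℝ x (v i))) atTop (nhds 0) := by
  choose p hp hmin using fun n =>
    exists_norm_sq_eq_and_le_of_gram (fun i : Fin n => v i) (A n) (hA n) (hdet n) x
  simp only [hp]
  have hspan : ∀ y ∈ Submodule.span ℝ (Set.range v),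
      ∀ᶠ n in atTop, y ∈ Submodule.span ℝ (Set.range fun i : Fin n => v i) := by
    intro y hy
    induction hy using Submodule.span_induction with
    | mem w hw =>
      obtain ⟨j, rfl⟩ := hw
      filter_upwards [eventually_gt_atTop j] with n hn
      exact Submodule.subset_span ⟨⟨j, hn⟩, rfl⟩
    | zero => exact Eventually.of_forall fun n => Submodule.zero_mem _
    | add w z _ _ hw hz =>
      filter_upwards [hw, hz] with n h₁ h₂ using Submodule.add_mem _ h₁ h₂
    | smul a w _ hw => filter_upwards [hw] with n h using Submodule.smul_mem _ a h
  have hnorm : Tendsto (fun n => ‖x - p n‖) atTop (nhds 0) := by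
    rw [Metric.tendsto_nhds]
    intro ε hε
    obtain ⟨y, hy, hxy⟩ := Metric.mem_closure_iff.mp hx ε hε
    filter_upwards [hspan y hy] with n hn
    rw [Real.dist_0_eq_abs, abs_norm]
    rw [dist_eq_norm] at hxy
    exact (pow_le_pow_iff_left₀ (norm_nonneg _) (norm_nonneg _) two_ne_zero).mp
      (hmin n y hn) |>.trans_lt hxy
  simpa using hnorm.pow 2

/-- A probability measure all of whose one-dimensional marginals are real Gaussians is Gaussian. -/
theorem isGaussian_of_forall_exists_gaussianReal {E : Type*} [NormedAddCommGroup E]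
    [NormedSpace ℝ E] [MeasurableSpace E] [BorelSpace E] (P : Measure E)
    (h : ∀ L : E →L[ℝ] ℝ, ∃ (m : ℝ) (v : NNReal), P.map L = gaussianReal m v) :
    IsGaussian P where
  map_eq_gaussianReal L := by
    obtain ⟨m, v, hL⟩ := h L
    have hm : ∫ ω, L ω ∂P = m := by
      rw [← integral_id_gaussianReal (μ := m) (v := v), ← hL,
        integral_map (by fun_prop) (by fun_prop)]
    have hv : Var[L; P] = v := by
      rw [← variance_id_gaussianReal (μ := m) (v := v), ← hL,
        variance_map (by fun_prop) (by fun_prop)]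
      rfl
    rw [hm, hv, Real.toNNReal_coe, hL]

/-- Under the hypotheses of STATEMENT 8 (Gaussian measure `P` with mean
`μ` and covariance kernel `K`, functionals `(L i)` separating `u`, positive definite
covariance matrices `Aₙ`), the conditional variances
`K(T,T) − bₙ(T)ᵀAₙ⁻¹bₙ(T)` converge to `0` for every `T ∈ E*`. -/
theorem kernel_variance_tendsto_zero
    {E : Type*} [NormedAddCommGroup E] [NormedSpace ℝ E] [CompleteSpace E]
    [TopologicalSpace.SeparableSpace E] [MeasurableSpace E] [BorelSpace E]
    (P : Measure E) [IsProbabilityMeasure P]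
    (hGauss : ∀ L : E →L[ℝ] ℝ, ∃ (m : ℝ) (v : NNReal), P.map L = gaussianReal m v)
    (μ : E) (hμ : μ = ∫ ω, ω ∂P)
    (K : (E →L[ℝ] ℝ) → (E →L[ℝ] ℝ) → ℝ)
    (hK : ∀ L₁ L₂ : E →L[ℝ] ℝ, K L₁ L₂ = ∫ ω, (L₁ ω - L₁ μ) * (L₂ ω - L₂ μ) ∂P)
    (u : E) (L : ℕ → (E →L[ℝ] ℝ))
    (hsep : ⋂ i, {ω : E | L i ω = L i u} = {u})
    (A : (n : ℕ) → Matrix (Fin n) (Fin n) ℝ)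
    (hA : ∀ (n : ℕ) (j k : Fin n), A n j k = K (L j) (L k))
    (hApd : ∀ n, (A n).PosDef)
    (T : E →L[ℝ] ℝ) :
    Tendsto
      (fun n : ℕ =>
        K T T - (fun i : Fin n => K T (L i)) ⬝ᵥ
          (A n)⁻¹.mulVec (fun i : Fin n => K T (L i)))
      atTop (nhds 0) := by
  have : SecondCountableTopology E := UniformSpace.secondCountable_of_separable E
  have := isGaussian_of_forall_exists_gaussianReal P hGauss
  have hmem : MemLp (fun ω : E => ω - μ) 2 P :=
    (IsGaussian.memLp_id P 2 (by simp)).sub (memLp_const μ)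
  have hξ (S : E →L[ℝ] ℝ) : MemLp (fun ω => S ω - S μ) 2 P := by
    simpa only [Function.comp_def, map_sub] using S.comp_memLp' hmem
  let ξ (S : E →L[ℝ] ℝ) : Lp ℝ 2 P := (hξ S).toLp
  have hKξ (S S' : E →L[ℝ] ℝ) : K S S' = inner ℝ (ξ S) (ξ S') := by
    rw [hK, L2.inner_def]
    refine integral_congr_ae ?_
    filter_upwards [(hξ S).coeFn_toLp, (hξ S').coeFn_toLp] with ω h h'
    rw [h, h', RCLike.inner_apply', conj_trivial]
  have hbar (h : Lp ℝ 2 P) (S : E →L[ℝ] ℝ) :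
      S (∫ ω, h ω • (ω - μ) ∂P) = inner ℝ h (ξ S) := by
    have hint : Integrable (fun ω => h ω • (ω - μ)) P :=
      memLp_one_iff_integrable.mp (hmem.smul (Lp.memLp h))
    rw [← S.integral_comp_comm hint, L2.inner_def]
    refine integral_congr_ae ?_
    filter_upwards [(hξ S).coeFn_toLp] with ω hω
    rw [hω, RCLike.inner_apply', conj_trivial, map_smul, map_sub, smul_eq_mul]
  have hclosure :
      ξ T ∈ (Submodule.span ℝ (Set.range fun i => ξ (L i))).topologicalClosure := by
    rw [← Submodule.orthogonal_orthogonal_eq_closure, Submodule.mem_orthogonal]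
    intro h hh
    have hL (i : ℕ) : L i (∫ ω, h ω • (ω - μ) ∂P) = 0 := by
      rw [hbar]
      exact Submodule.inner_left_of_mem_orthogonal
        (Submodule.subset_span (Set.mem_range_self i)) hh
    have hu : u + ∫ ω, h ω • (ω - μ) ∂P ∈ ⋂ i, {ω : E | L i ω = L i u} :=
      Set.mem_iInter.mpr fun i => by simp [hL i]
    rw [hsep, Set.mem_singleton_iff, add_eq_left] at hu
    rw [← hbar, hu, map_zero]
  simp only [hKξ] at hA ⊢
  exact tendsto_gram_schur_complement_zero (fun i => ξ (L i)) A hA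
    (fun n => (hApd n).det_pos.ne'.isUnit) hclosure
end

section
/- Let E be a real separable Banach space and P a Gaussian Borel probability measure on E with mean μ := ∫_E ω dP(ω) and covariance kernel K(L₁,L₂) := ∫_E (L₁ω − L₁μ)(L₂ω − L₂μ) dP(ω). Let U : E → ℝ be Borel measurable with ∫_E U(ω)² dP(ω) < ∞, and suppose u := ∫_E ω U(ω) dP(ω) (Bochner integral). Let L, L₁,…,Lₙ ∈ E* with A_n := (K(L_j,L_k))_{j,k=1}^n positive definite, and set b_n(L) := (K(L,L₁),…,K(L,Lₙ))ᵀ, β := A_n⁻¹ b_n(L), m_n := (L₁μ,…,Lₙμ)ᵀ, f_n := (L₁u,…,Lₙu)ᵀ, σ_n(L) := (K(L,L) − b_n(L)ᵀA_n⁻¹b_n(L))^{1/2}, C₁ := (∫_E U² dP)^{1/2}, and C₂ := |∫_E U dP − 1|. Then the kernel-based estimator s_n(L) := Lμ + βᵀ(f_n − m_n) satisfies |Lu − s_n(L)| ≤ C₁ σ_n(L) + C₂ |Lμ − βᵀ m_n|. -/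
open MeasureTheory ProbabilityTheory Matrix

/-- Cauchy-Schwarz inequality for square-integrable real functions. -/
lemma abs_integral_mul_le_sqrt_mul_sqrt {Ω : Type*} [MeasurableSpace Ω] {P : Measure Ω}
    {f g : Ω → ℝ} (hf : MemLp f 2 P) (hg : MemLp g 2 P) :
    |∫ ω, f ω * g ω ∂P| ≤ Real.sqrt (∫ ω, f ω ^ 2 ∂P) * Real.sqrt (∫ ω, g ω ^ 2 ∂P) := by
  have holder := integral_mul_norm_le_Lp_mul_Lq (μ := P) (f := f) (g := g)
    Real.HolderConjugate.two_two (by simpa using hf) (by simpa using hg)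
  simp only [Real.norm_eq_abs, Real.rpow_two, sq_abs, ← Real.sqrt_eq_rpow] at holder
  refine abs_integral_le_integral_abs.trans ?_
  simpa only [abs_mul] using holder

/-- The covariance of the residual `T - ∑ i, (A⁻¹ b) i • L i` of the regression of `T` on the
functionals `L i` with respect to a symmetric bilinear form is the Schur complement. -/
lemma bilin_residual_self_eq {V : Type*} [AddCommGroup V] [Module ℝ V] {ι : Type*} [Fintype ι]
    [DecidableEq ι] (B : LinearMap.BilinForm ℝ V) (hB : ∀ x y, B x y = B y x) (T : V) (L : ι → V)
    {A : Matrix ι ι ℝ} (hA : ∀ j k, A j k = B (L j) (L k)) (hdet : IsUnit A.det)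
    {b : ι → ℝ} (hb : ∀ i, b i = B T (L i)) {β : ι → ℝ} (hβ : β = A⁻¹ *ᵥ b) :
    B (T - ∑ i, β i • L i) (T - ∑ i, β i • L i) = B T T - b ⬝ᵥ β := by
  have hAβ : A *ᵥ β = b := by
    rw [hβ, mulVec_mulVec, mul_nonsing_inv A hdet, one_mulVec]
  have orth (i : ι) : B (L i) (T - ∑ j, β j • L j) = 0 := by
    have h := congrFun hAβ i
    simp only [mulVec, dotProduct, hA, hb] at h
    simp only [map_sub, map_sum, map_smul, smul_eq_mul, hB (L i) T, ← h]
    simp [mul_comm]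
  have h : B (∑ i, β i • L i) (T - ∑ i, β i • L i) = 0 := by
    rw [map_sum, LinearMap.sum_apply]
    simp [-map_sub, orth]
  rw [LinearMap.map_sub₂, h]
  simp [dotProduct, hb, mul_comm]

/-- Splitting of the error of a functional at the weighted mean into a covariance term and a bias
term. -/
lemma abs_apply_integral_smul_sub_le {E : Type*} [NormedAddCommGroup E] [NormedSpace ℝ E]
    [CompleteSpace E] [MeasurableSpace E] {P : Measure E} [IsProbabilityMeasure P]
    (hid : MemLp id 2 P) {U : E → ℝ} (hU : MemLp U 2 P) (R : E →L[ℝ] ℝ) (μ : E) :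
    |R (∫ ω, U ω • ω ∂P) - R μ| ≤
      Real.sqrt (∫ ω, U ω ^ 2 ∂P) * Real.sqrt (∫ ω, (R ω - R μ) ^ 2 ∂P) +
        |(∫ ω, U ω ∂P) - 1| * |R μ| := by
  have hR : MemLp (fun ω => R ω - R μ) 2 P :=
    (R.comp_memLp' hid).sub (memLp_const (R μ))
  have hUid : Integrable (fun ω => U ω • ω) P :=
    memLp_one_iff_integrable.1 (hid.smul hU)
  have hsplit : R (∫ ω, U ω • ω ∂P) - R μ =
      (∫ ω, U ω * (R ω - R μ) ∂P) + ((∫ ω, U ω ∂P) - 1) * R μ := by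
    have hUR : Integrable (fun ω => U ω * R ω) P := by
      simpa using R.integrable_comp hUid
    have hUc : Integrable (fun ω => U ω * R μ) P :=
      (hU.integrable one_le_two).mul_const _
    rw [← R.integral_comp_comm hUid]
    simp only [map_smul, smul_eq_mul, mul_sub]
    rw [integral_sub hUR hUc, integral_mul_const]
    ring
  rw [hsplit, ← abs_mul]
  exact (abs_add_le _ _).trans (add_le_add_left (abs_integral_mul_le_sqrt_mul_sqrt hU hR) _)

/-- Error bound for the kernel-based estimator. `P` is a Gaussian
Borel probability measure on a real separable Banach space with mean `μ` and
covariance kernel `K`; `U ∈ L²(P)` and `u = ∫ ω U(ω) dP(ω)` (Bochner). With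
`b = (K(T,L₁),…,K(T,Lₙ))`, `β = Aₙ⁻¹b`, `σₙ(T)² = K(T,T) − bᵀAₙ⁻¹b`,
`C₁ = (∫U²dP)^{1/2}`, `C₂ = |∫UdP − 1|`, the estimator
`sₙ(T) = Tμ + βᵀ(fₙ − mₙ)` satisfies
`|Tu − sₙ(T)| ≤ C₁σₙ(T) + C₂|Tμ − βᵀmₙ|`. -/
theorem kernel_estimator_error_bound
    {E : Type*} [NormedAddCommGroup E] [NormedSpace ℝ E] [CompleteSpace E]
    [TopologicalSpace.SeparableSpace E] [MeasurableSpace E] [BorelSpace E]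
    (P : Measure E) [IsProbabilityMeasure P]
    (hGauss : ∀ L : E →L[ℝ] ℝ, ∃ (m : ℝ) (v : NNReal), P.map L = gaussianReal m v)
    (μ : E) (hμ : μ = ∫ ω, ω ∂P)
    (K : (E →L[ℝ] ℝ) → (E →L[ℝ] ℝ) → ℝ)
    (hK : ∀ L₁ L₂ : E →L[ℝ] ℝ, K L₁ L₂ = ∫ ω, (L₁ ω - L₁ μ) * (L₂ ω - L₂ μ) ∂P)
    (U : E → ℝ) (hUmeas : Measurable U)
    (hU2 : Integrable (fun ω => U ω ^ 2) P)
    (u : E) (hu : u = ∫ ω, U ω • ω ∂P)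
    {n : ℕ} (T : E →L[ℝ] ℝ) (L : Fin n → (E →L[ℝ] ℝ))
    (A : Matrix (Fin n) (Fin n) ℝ) (hA : ∀ j k, A j k = K (L j) (L k))
    (hApd : A.PosDef)
    (b : Fin n → ℝ) (hb : ∀ i, b i = K T (L i))
    (β : Fin n → ℝ) (hβ : β = A⁻¹.mulVec b) :
    |T u - (T μ + β ⬝ᵥ (fun i => L i u - L i μ))| ≤
      Real.sqrt (∫ ω, U ω ^ 2 ∂P) * Real.sqrt (K T T - b ⬝ᵥ A⁻¹.mulVec b) +
        |(∫ ω, U ω ∂P) - 1| * |T μ - β ⬝ᵥ (fun i => L i μ)| := by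
  have : SecondCountableTopology E := UniformSpace.secondCountable_of_separable E
  have : IsGaussian P := isGaussian_of_map_eq_gaussianReal hGauss
  have hid : MemLp id 2 P := IsGaussian.memLp_two_id
  have hU : MemLp U 2 P :=
    (memLp_two_iff_integrable_sq hUmeas.aestronglyMeasurable).2 hU2
  have hcov (L₁ L₂ : E →L[ℝ] ℝ) : K L₁ L₂ = (covarianceBilinDual P).toBilinForm L₁ L₂ := by
    rw [hK, hμ]
    simpa using (covarianceBilinDual_apply' hid L₁ L₂).symm
  set R : E →L[ℝ] ℝ := T - ∑ i, β i • L i with hRdef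
  have hR (x : E) : R x = T x - β ⬝ᵥ (fun i => L i x) := by
    simp [hRdef, dotProduct]
  have hvar : K T T - b ⬝ᵥ A⁻¹.mulVec b = ∫ ω, (R ω - R μ) ^ 2 ∂P := by
    have h := bilin_residual_self_eq (covarianceBilinDual P).toBilinForm
      covarianceBilinDual_comm T L (fun j k => (hA j k).trans (hcov _ _))
      ((isUnit_iff_isUnit_det A).1 hApd.isUnit) (fun i => (hb i).trans (hcov _ _)) hβ
    rw [← hβ, hcov T T, ← h, ← hRdef, ← hcov, hK]
    simp only [sq]
  have herr : T u - (T μ + β ⬝ᵥ (fun i => L i u - L i μ)) = R u - R μ := by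
    have h : β ⬝ᵥ (fun i => L i u - L i μ) =
        β ⬝ᵥ (fun i => L i u) - β ⬝ᵥ (fun i => L i μ) := dotProduct_sub _ _ _
    rw [hR, hR, h]
    ring
  rw [herr, hvar, ← hR, hu]
  exact abs_apply_integral_smul_sub_le hid hU R μ
end
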